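/- Let $R$ be a complete Gorenstein commutative noetherian local ring and let $0 \to A \xrightarrow{f} B \xrightarrow{g} C \to 0$ be a short exact sequence of objects in $\mathcal{G}$ (Gorenstein projective objects of the morphism category). Then this sequence is an almost split sequence in $\mathcal{G}$ if and only if the induced sequence of cokernel objects $0 \to \mathbf{Cok}(f) \to \mathbf{Cok}(g') \to \mathbf{Cok}(h) \to 0$ (applying the cokernel functor to each object) is an almost split sequence in $\mathcal{E}$, the subcategory of epimorphisms between Gorenstein projective modules. -/

import Mathlib

open LinearMap Function

/-- A bundled module over a ring `S`. -/
structure Mdl (S : Type) [Ring S] : Type 1 where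
  carrier : Type
  [ag : AddCommGroup carrier]
  [mod : Module S carrier]

attribute [instance] Mdl.ag Mdl.mod

instance {S : Type} [Ring S] : CoeSort (Mdl S) Type := ⟨Mdl.carrier⟩

/-- Bundle a module. -/
def Mdl.of (S : Type) [Ring S] (M : Type) [AddCommGroup M] [Module S M] : Mdl S := ⟨M⟩

section RingDefs

variable {S : Type} [Ring S]

/-- finitely generated projective -/
def FGProj (P : Mdl S) : Prop := Module.Projective S P.carrier ∧ Module.Finite S P.carrier

/-- superfluous (small) submodule -/
def Superfluous {P : Type} [AddCommGroup P] [Module S P] (K : Submodule S P) : Prop :=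
  ∀ N : Submodule S P, N ⊔ K = ⊤ → N = ⊤

/-- projective cover of a module -/
def IsProjCover {P M : Mdl S} (p : P.carrier →ₗ[S] M.carrier) : Prop :=
  FGProj P ∧ Function.Surjective p ∧ Superfluous (LinearMap.ker p)

/-- `N` is a (minimal) first syzygy of `M`. -/
def IsSyz1 (M N : Mdl S) : Prop :=
  ∃ (P : Mdl S) (p : P.carrier →ₗ[S] M.carrier),
    IsProjCover p ∧ Nonempty (N.carrier ≃ₗ[S] LinearMap.ker p)

/-- `N` is an `n`-th (minimal) syzygy of `M`. -/
def IsSyz (n : ℕ) (M N : Mdl S) : Prop :=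
  ∃ F : Fin (n + 1) → Mdl S,
    Nonempty ((F 0).carrier ≃ₗ[S] M.carrier) ∧
    Nonempty ((F (Fin.last n)).carrier ≃ₗ[S] N.carrier) ∧
    ∀ i : Fin n, IsSyz1 (F i.castSucc) (F i.succ)

/-- Gorenstein projective: a syzygy of a totally acyclic complex of
finitely generated projectives. -/
def IsGP (M : Mdl S) : Prop :=
  ∃ (P : ℤ → Mdl S) (d : ∀ i : ℤ, (P (i + 1)).carrier →ₗ[S] (P i).carrier),
    (∀ i, FGProj (P i)) ∧
    (∀ i, LinearMap.range (d (i + 1)) = LinearMap.ker (d i)) ∧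
    (∀ (Q : Mdl S), Module.Projective S Q.carrier →
      ∀ (i : ℤ) (g : (P (i + 1)).carrier →ₗ[S] Q.carrier), g ∘ₗ d (i + 1) = 0 →
        ∃ h : (P i).carrier →ₗ[S] Q.carrier, h ∘ₗ d i = g) ∧
    Nonempty (M.carrier ≃ₗ[S] LinearMap.ker (d 0))

/-- a map factoring through a projective module -/
def FactorsThruProj {A B : Mdl S} (φ : A.carrier →ₗ[S] B.carrier) : Prop :=
  ∃ (Q : Mdl S) (α : A.carrier →ₗ[S] Q.carrier) (β : Q.carrier →ₗ[S] B.carrier),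
    Module.Projective S Q.carrier ∧ β ∘ₗ α = φ

/-- `M` is stable: it has no nonzero projective direct summand. -/
def NoProjSummand (M : Mdl S) : Prop :=
  ∀ N Q : Mdl S, Nonempty (M.carrier ≃ₗ[S] (N.carrier × Q.carrier)) →
    Module.Projective S Q.carrier → Subsingleton Q.carrier

/-- indecomposable module -/
def IndecMod (M : Mdl S) : Prop :=
  Nontrivial M.carrier ∧
  ∀ N Q : Mdl S, Nonempty (M.carrier ≃ₗ[S] (N.carrier × Q.carrier)) →
    Subsingleton N.carrier ∨ Subsingleton Q.carrier

end RingDefs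
section MorCat

variable {R : Type} [CommRing R]

/-- An object of the morphism category `𝓜`. -/
structure MObj (R : Type) [CommRing R] : Type 1 where
  dom : Mdl R
  cod : Mdl R
  map : dom.carrier →ₗ[R] cod.carrier

/-- A morphism in the morphism category: a commutative square. -/
structure MHom (f g : MObj R) : Type where
  h1 : f.dom.carrier →ₗ[R] g.dom.carrier
  h2 : f.cod.carrier →ₗ[R] g.cod.carrier
  comm : g.map ∘ₗ h1 = h2 ∘ₗ f.map

/-- isomorphism in the morphism category -/
def MIso (f g : MObj R) : Prop :=
  ∃ (e1 : f.dom.carrier ≃ₗ[R] g.dom.carrier) (e2 : f.cod.carrier ≃ₗ[R] g.cod.carrier),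
    g.map ∘ₗ (e1 : f.dom.carrier →ₗ[R] g.dom.carrier)
      = (e2 : f.cod.carrier →ₗ[R] g.cod.carrier) ∘ₗ f.map

/-- epimorphism in the morphism category (componentwise surjective) -/
def MEpi {f g : MObj R} (φ : MHom f g) : Prop :=
  Function.Surjective φ.h1 ∧ Function.Surjective φ.h2

/-- projective object of the morphism category -/
def MProj (f : MObj R) : Prop :=
  ∀ (g h : MObj R) (e : MHom g h), MEpi e → ∀ φ : MHom f h,
    ∃ ψ : MHom f g, e.h1 ∘ₗ ψ.h1 = φ.h1 ∧ e.h2 ∘ₗ ψ.h2 = φ.h2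

/-- projective cover in the morphism category: a right minimal epimorphism
from a projective object -/
def MProjCover {q f : MObj R} (φ : MHom q f) : Prop :=
  MProj q ∧ MEpi φ ∧
  ∀ ξ : MHom q q, φ.h1 ∘ₗ ξ.h1 = φ.h1 → φ.h2 ∘ₗ ξ.h2 = φ.h2 →
    Function.Bijective ξ.h1 ∧ Function.Bijective ξ.h2

/-- `g` is a first syzygy of `f` in the morphism category. -/
def MSyz1 (f g : MObj R) : Prop :=
  ∃ (q : MObj R) (φ : MHom q f), MProjCover φ ∧
    ∃ k : (LinearMap.ker φ.h1 : Type) →ₗ[R] (LinearMap.ker φ.h2 : Type),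
      (LinearMap.ker φ.h2).subtype ∘ₗ k = q.map ∘ₗ (LinearMap.ker φ.h1).subtype ∧
      MIso g ⟨Mdl.of R (LinearMap.ker φ.h1), Mdl.of R (LinearMap.ker φ.h2), k⟩

/-- `g` is an `n`-th syzygy of `f` in the morphism category. -/
def MSyz (n : ℕ) (f g : MObj R) : Prop :=
  ∃ F : Fin (n + 1) → MObj R,
    MIso (F 0) f ∧ MIso (F (Fin.last n)) g ∧
    ∀ i : Fin n, MSyz1 (F i.castSucc) (F i.succ)

/-- `g` is the induced map on (minimal) first syzygies of the map `f`. -/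
def MapSyz1 (f g : MObj R) : Prop :=
  ∃ (PA PB : Mdl R) (pA : PA.carrier →ₗ[R] f.dom.carrier)
    (pB : PB.carrier →ₗ[R] f.cod.carrier) (L : PA.carrier →ₗ[R] PB.carrier),
    IsProjCover pA ∧ IsProjCover pB ∧ f.map ∘ₗ pA = pB ∘ₗ L ∧
    ∃ k : (LinearMap.ker pA : Type) →ₗ[R] (LinearMap.ker pB : Type),
      (LinearMap.ker pB).subtype ∘ₗ k = L ∘ₗ (LinearMap.ker pA).subtype ∧
      MIso g ⟨Mdl.of R (LinearMap.ker pA), Mdl.of R (LinearMap.ker pB), k⟩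

/-- `g` is the induced map on minimal `n`-th syzygies of the map `f`. -/
def MapSyz (n : ℕ) (f g : MObj R) : Prop :=
  ∃ F : Fin (n + 1) → MObj R,
    MIso (F 0) f ∧ MIso (F (Fin.last n)) g ∧
    ∀ i : Fin n, MapSyz1 (F i.castSucc) (F i.succ)

/-- direct sum in the morphism category -/
def DSum (f g : MObj R) : MObj R :=
  ⟨Mdl.of R (f.dom.carrier × g.dom.carrier), Mdl.of R (f.cod.carrier × g.cod.carrier),
    f.map.prodMap g.map⟩

/-- the zero object, up to iso -/
def MTrivial (f : MObj R) : Prop := Subsingleton f.dom.carrier ∧ Subsingleton f.cod.carrier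

/-- indecomposable object of the morphism category -/
def MIndec (f : MObj R) : Prop :=
  ¬ MTrivial f ∧ ∀ g h : MObj R, MIso f (DSum g h) → MTrivial g ∨ MTrivial h

/-- the endomorphism ring of `f` in the morphism category is local -/
def MEndLocal (f : MObj R) : Prop :=
  ¬ MTrivial f ∧
  ∀ ξ : MHom f f,
    (Function.Bijective ξ.h1 ∧ Function.Bijective ξ.h2) ∨
    (Function.Bijective ((LinearMap.id : f.dom.carrier →ₗ[R] f.dom.carrier) - ξ.h1) ∧
     Function.Bijective ((LinearMap.id : f.cod.carrier →ₗ[R] f.cod.carrier) - ξ.h2))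

/-- no nonzero projective direct summand in the morphism category -/
def MNoProjSummand (f : MObj R) : Prop :=
  ∀ g q : MObj R, MIso f (DSum g q) → MProj q → MTrivial q

/-- the cokernel module of an object -/
def CokMod (f : MObj R) : Mdl R := Mdl.of R (f.cod.carrier ⧸ LinearMap.range f.map)

/-- the cokernel object `Cok(f) : B → Cok f` -/
def CokObj (f : MObj R) : MObj R := ⟨f.cod, CokMod f, (LinearMap.range f.map).mkQ⟩

/-- Gorenstein projective objects of the morphism category -/
def InG (f : MObj R) : Prop :=
  Function.Injective f.map ∧ IsGP f.dom ∧ IsGP (CokMod f)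

/-- objects of `𝓗`: morphisms between Gorenstein projective modules -/
def InH (f : MObj R) : Prop := IsGP f.dom ∧ IsGP f.cod

/-- objects of `𝓔`: epimorphisms between Gorenstein projective modules -/
def InE (f : MObj R) : Prop := InH f ∧ Function.Surjective f.map

/-- `𝓖`-precover -/
def IsGPrecover {g x : MObj R} (φ : MHom g x) : Prop :=
  InG g ∧ ∀ g' : MObj R, InG g' → ∀ ψ : MHom g' x,
    ∃ ξ : MHom g' g, φ.h1 ∘ₗ ξ.h1 = ψ.h1 ∧ φ.h2 ∘ₗ ξ.h2 = ψ.h2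

/-- right minimal morphism -/
def MRightMin {g x : MObj R} (φ : MHom g x) : Prop :=
  ∀ ξ : MHom g g, φ.h1 ∘ₗ ξ.h1 = φ.h1 → φ.h2 ∘ₗ ξ.h2 = φ.h2 →
    Function.Bijective ξ.h1 ∧ Function.Bijective ξ.h2

/-- `𝓖`-cover -/
def IsGCover {g x : MObj R} (φ : MHom g x) : Prop := IsGPrecover φ ∧ MRightMin φ

/-- `𝓔`-preenvelope -/
def IsEPreenvelope {x e : MObj R} (φ : MHom x e) : Prop :=
  InE e ∧ ∀ e' : MObj R, InE e' → ∀ ψ : MHom x e',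
    ∃ ξ : MHom e e', ξ.h1 ∘ₗ φ.h1 = ψ.h1 ∧ ξ.h2 ∘ₗ φ.h2 = ψ.h2

/-- left minimal morphism -/
def MLeftMin {x e : MObj R} (φ : MHom x e) : Prop :=
  ∀ ξ : MHom e e, ξ.h1 ∘ₗ φ.h1 = φ.h1 → ξ.h2 ∘ₗ φ.h2 = φ.h2 →
    Function.Bijective ξ.h1 ∧ Function.Bijective ξ.h2

/-- `𝓔`-envelope -/
def IsEEnvelope {x e : MObj R} (φ : MHom x e) : Prop := IsEPreenvelope φ ∧ MLeftMin φ

/-- injective objects of `𝓗`: sums of `(P → P)` and `(P → 0)`,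
i.e. objects isomorphic to a projection `P × P' → P`. -/
def HInj (q : MObj R) : Prop :=
  ∃ P P' : Mdl R, FGProj P ∧ FGProj P' ∧
    MIso q ⟨Mdl.of R (P.carrier × P'.carrier), P, LinearMap.fst R P.carrier P'.carrier⟩

/-- no nonzero `𝓗`-injective direct summand -/
def MNoHInjSummand (f : MObj R) : Prop :=
  ∀ g q : MObj R, MIso f (DSum g q) → HInj q → MTrivial q

/-- `s` is (isomorphic to) the reduced `𝓖`-cover of `x` -/
def IsRedGCover (s x : MObj R) : Prop :=
  ∃ (g : MObj R) (φ : MHom g x), IsGCover φ ∧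
    ∃ q : MObj R, MProj q ∧ MIso g (DSum s q) ∧ MNoProjSummand s

/-- `s` is (isomorphic to) the reduced `𝓔`-envelope of `x` -/
def IsRedEEnvelope (s x : MObj R) : Prop :=
  ∃ (e : MObj R) (φ : MHom x e), IsEEnvelope φ ∧
    ∃ q : MObj R, HInj q ∧ MIso e (DSum s q) ∧ MNoHInjSummand s

/-- Auslander transpose of a module -/
def IsTranspose (M T : Mdl R) : Prop :=
  ∃ (P1 P0 : Mdl R) (d : P1.carrier →ₗ[R] P0.carrier) (p : P0.carrier →ₗ[R] M.carrier),
    FGProj P1 ∧ FGProj P0 ∧ Function.Surjective p ∧ Superfluous (LinearMap.ker p) ∧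
    LinearMap.range d = LinearMap.ker p ∧ Superfluous (LinearMap.ker d) ∧
    Nonempty (T.carrier ≃ₗ[R] (Module.Dual R P1.carrier ⧸ LinearMap.range d.dualMap))

/-- `L` is `λ M = Ω¹ Tr M`. -/
def LambdaOf (M L : Mdl R) : Prop := ∃ T : Mdl R, IsTranspose M T ∧ IsSyz1 T L

/-- horizontally linked module -/
def HorLinkedMod (M : Mdl R) : Prop :=
  ∃ L L2 : Mdl R, LambdaOf M L ∧ LambdaOf L L2 ∧ Nonempty (M.carrier ≃ₗ[R] L2.carrier)

/-- the Auslander transpose in the morphism category, computed by dualizing a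
(componentwise) minimal projective presentation
`(P₁ → P₁ ⊕ Q₁) → (P₀ → P₀ ⊕ Q₀) → f → 0` in `𝓜` against `𝐫 = (R → R ⊕ R)`. -/
def IsMTranspose (f t : MObj R) : Prop :=
  ∃ (P1 Q1 P0 Q0 : Mdl R)
    (u : P1.carrier →ₗ[R] P0.carrier)
    (v : (P1.carrier × Q1.carrier) →ₗ[R] (P0.carrier × Q0.carrier))
    (p : P0.carrier →ₗ[R] f.dom.carrier)
    (q : (P0.carrier × Q0.carrier) →ₗ[R] f.cod.carrier),
    FGProj P1 ∧ FGProj Q1 ∧ FGProj P0 ∧ FGProj Q0 ∧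
    v ∘ₗ LinearMap.inl R P1.carrier Q1.carrier = LinearMap.inl R P0.carrier Q0.carrier ∘ₗ u ∧
    q ∘ₗ LinearMap.inl R P0.carrier Q0.carrier = f.map ∘ₗ p ∧
    Function.Surjective p ∧ Function.Surjective q ∧
    Superfluous (LinearMap.ker p) ∧ Superfluous (LinearMap.ker q) ∧
    LinearMap.range u = LinearMap.ker p ∧ LinearMap.range v = LinearMap.ker q ∧
    Superfluous (LinearMap.ker u) ∧ Superfluous (LinearMap.ker v) ∧
    ∃ (e1 : t.dom.carrier ≃ₗ[R]
        (Module.Dual R Q1.carrier ⧸ LinearMap.range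
          (LinearMap.snd R P0.carrier Q0.carrier ∘ₗ v ∘ₗ
            LinearMap.inr R P1.carrier Q1.carrier).dualMap))
      (e2 : t.cod.carrier ≃ₗ[R]
        (Module.Dual R (P1.carrier × Q1.carrier) ⧸ LinearMap.range v.dualMap))
      (tt : (Module.Dual R Q1.carrier ⧸ LinearMap.range
          (LinearMap.snd R P0.carrier Q0.carrier ∘ₗ v ∘ₗ
            LinearMap.inr R P1.carrier Q1.carrier).dualMap) →ₗ[R]
        (Module.Dual R (P1.carrier × Q1.carrier) ⧸ LinearMap.range v.dualMap)),
      tt ∘ₗ (LinearMap.range (LinearMap.snd R P0.carrier Q0.carrier ∘ₗ v ∘ₗ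
          LinearMap.inr R P1.carrier Q1.carrier).dualMap).mkQ
        = (LinearMap.range v.dualMap).mkQ ∘ₗ (LinearMap.snd R P1.carrier Q1.carrier).dualMap ∧
      (e2 : t.cod.carrier →ₗ[R] _) ∘ₗ t.map = tt ∘ₗ (e1 : t.dom.carrier →ₗ[R] _)

/-- `g ≅ λ_𝓜 f = Ω¹_𝓜 Tr_𝓜 f` -/
def MLambda (f g : MObj R) : Prop := ∃ t : MObj R, IsMTranspose f t ∧ MSyz1 t g

/-- horizontally linked object of the submodule category -/
def MHorLinked (f : MObj R) : Prop :=
  ∃ g h : MObj R, MLambda f g ∧ MLambda g h ∧ MIso f h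

/-- the dual object `(B' → A')` of `(A → B)` -/
def DualObj (f : MObj R) : MObj R :=
  ⟨Mdl.of R (Module.Dual R f.cod.carrier), Mdl.of R (Module.Dual R f.dom.carrier), f.map.dualMap⟩

/-- componentwise short exact sequence in the morphism category -/
def MShortExact {a b c : MObj R} (φ : MHom a b) (ψ : MHom b c) : Prop :=
  Function.Injective φ.h1 ∧ Function.Injective φ.h2 ∧
  Function.Surjective ψ.h1 ∧ Function.Surjective ψ.h2 ∧
  LinearMap.range φ.h1 = LinearMap.ker ψ.h1 ∧
  LinearMap.range φ.h2 = LinearMap.ker ψ.h2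

/-- split monomorphism -/
def MSplitMono {a b : MObj R} (φ : MHom a b) : Prop :=
  ∃ σ : MHom b a, σ.h1 ∘ₗ φ.h1 = LinearMap.id ∧ σ.h2 ∘ₗ φ.h2 = LinearMap.id

/-- split epimorphism -/
def MSplitEpi {x c : MObj R} (θ : MHom x c) : Prop :=
  ∃ σ : MHom c x, θ.h1 ∘ₗ σ.h1 = LinearMap.id ∧ θ.h2 ∘ₗ σ.h2 = LinearMap.id

/-- almost split sequence in a full subcategory `C` of the morphism category -/
def IsAlmostSplitIn (C : MObj R → Prop) {a b c : MObj R}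
    (φ : MHom a b) (ψ : MHom b c) : Prop :=
  C a ∧ C b ∧ C c ∧ MShortExact φ ψ ∧ ¬ MSplitMono φ ∧ MEndLocal a ∧
  ∀ x : MObj R, C x → ∀ θ : MHom x c, ¬ MSplitEpi θ →
    ∃ ρ : MHom x b, ψ.h1 ∘ₗ ρ.h1 = θ.h1 ∧ ψ.h2 ∘ₗ ρ.h2 = θ.h2

end MorCat

/-- A Gorenstein local ring: noetherian local, and some fixed syzygy functor lands in
Gorenstein projective (maximal Cohen-Macaulay) modules. -/
def IsGorensteinLocal (R : Type) [CommRing R] : Prop :=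
  IsNoetherianRing R ∧ IsLocalRing R ∧
  ∃ n : ℕ, ∀ M : Mdl R, Module.Finite R M.carrier → ∀ N : Mdl R, IsSyz n M N → IsGP N

section ShortExactSequences

variable {S : Type} [Ring S]

/-- There is a short exact sequence `0 → A → B → C → 0`. -/
def HasSES (A B C : Mdl S) : Prop :=
  ∃ (i : A.carrier →ₗ[S] B.carrier) (p : B.carrier →ₗ[S] C.carrier),
    Injective i ∧ Surjective p ∧ Exact i p

/-- Maps to projective modules extend along monomorphisms with cokernel `M`,
i.e. `Ext¹(M, Q) = 0` for all projective modules `Q`. -/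
def ExtVanishes (M : Mdl S) : Prop :=
  ∀ Q : Mdl S, Module.Projective S Q.carrier →
    ∀ (A B : Mdl S) (i : A.carrier →ₗ[S] B.carrier) (p : B.carrier →ₗ[S] M.carrier),
      Injective i → Surjective p → Exact i p →
        ∀ f : A.carrier →ₗ[S] Q.carrier, ∃ F : B.carrier →ₗ[S] Q.carrier, F ∘ₗ i = f

/-- `0 → M → P → N → 0` with `P` finitely generated projective. -/
def SyzRel (M N : Mdl S) : Prop := ∃ P : Mdl S, FGProj P ∧ HasSES M P N

/-- A class of modules closed under chosen syzygies and cosyzygies, whose members have no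
extensions by projective modules. -/
structure SyzClosed (C : Mdl S → Prop) : Prop where
  syz : ∀ M, C M → ∃ K, C K ∧ SyzRel K M
  cosyz : ∀ M, C M → ∃ N, C N ∧ SyzRel M N
  ext : ∀ M, C M → ExtVanishes M

theorem exists_comp_eq_of_ker_le {A B C : Type} [AddCommGroup A] [AddCommGroup B]
    [AddCommGroup C] [Module S A] [Module S B] [Module S C] (u : A →ₗ[S] B)
    (hu : Surjective u) (v : A →ₗ[S] C) (h : ∀ x, u x = 0 → v x = 0) :
    ∃ w : B →ₗ[S] C, w ∘ₗ u = v := by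
  refine ⟨(LinearMap.ker u).liftQ v (fun x hx => h x hx) ∘ₗ
    (u.quotKerEquivOfSurjective hu).symm.toLinearMap, ?_⟩
  ext x
  have : (u.quotKerEquivOfSurjective hu).symm (u x) = (LinearMap.ker u).mkQ x := by
    rw [LinearEquiv.symm_apply_eq]; rfl
  rw [LinearMap.comp_apply, LinearMap.comp_apply, LinearEquiv.coe_coe, this]
  exact (LinearMap.ker u).liftQ_apply v x

theorem exists_comp_eq_of_range_le {A B C : Type} [AddCommGroup A] [AddCommGroup B]
    [AddCommGroup C] [Module S A] [Module S B] [Module S C] (u : B →ₗ[S] C)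
    (hu : Injective u) (v : A →ₗ[S] C) (h : ∀ x, ∃ y, u y = v x) :
    ∃ w : A →ₗ[S] B, u ∘ₗ w = v := by
  refine ⟨(LinearEquiv.ofInjective u hu).symm.toLinearMap ∘ₗ
    v.codRestrict (LinearMap.range u) h, ?_⟩
  ext x
  exact congrArg Subtype.val ((LinearEquiv.ofInjective u hu).apply_symm_apply
    (v.codRestrict (LinearMap.range u) h x))

theorem isGP_of_equiv {M N : Mdl S} (e : M.carrier ≃ₗ[S] N.carrier) (h : IsGP M) : IsGP N := by
  obtain ⟨P, d, h1, h2, h3, ⟨e'⟩⟩ := h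
  exact ⟨P, d, h1, h2, h3, ⟨e.symm.trans e'⟩⟩

theorem hasSES_ker {A B : Mdl S} (f : A.carrier →ₗ[S] B.carrier) (hf : Surjective f) :
    HasSES (Mdl.of S (LinearMap.ker f)) A B :=
  ⟨(LinearMap.ker f).subtype, f, Subtype.val_injective, hf, LinearMap.exact_subtype_ker_map f⟩

theorem hasSES_coker {A B : Mdl S} (f : A.carrier →ₗ[S] B.carrier) (hf : Injective f) :
    HasSES A B (Mdl.of S (B.carrier ⧸ LinearMap.range f)) :=
  ⟨f, (LinearMap.range f).mkQ, hf, Submodule.mkQ_surjective _, LinearMap.exact_map_mkQ_range f⟩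

theorem exists_int_chain {α : Type*} (C : α → Prop) (r : α → α → Prop)
    (hl : ∀ x, C x → ∃ y, C y ∧ r y x) (hr : ∀ x, C x → ∃ y, C y ∧ r x y) (x : α) (hx : C x) :
    ∃ W : ℤ → α, W 0 = x ∧ (∀ i, C (W i)) ∧ ∀ i, r (W (i + 1)) (W i) := by
  choose l hlC hl using hl
  choose g hgC hg using hr
  let L : ℕ → {x // C x} := fun n => Nat.rec ⟨x, hx⟩ (fun _ y => ⟨l y.1 y.2, hlC y.1 y.2⟩) n
  let G : ℕ → {x // C x} := fun n => Nat.rec ⟨x, hx⟩ (fun _ y => ⟨g y.1 y.2, hgC y.1 y.2⟩) n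
  let W : ℤ → {x // C x} := fun i => match i with
    | Int.ofNat n => L n
    | Int.negSucc n => G (n + 1)
  refine ⟨fun i => (W i).1, rfl, fun i => (W i).2, fun i => ?_⟩
  match i with
  | Int.ofNat n => exact hl (L n).1 (L n).2
  | Int.negSucc 0 => exact hg (G 0).1 (G 0).2
  | Int.negSucc (n + 1) => exact hg (G (n + 1)).1 (G (n + 1)).2

theorem SyzClosed.isGP {C : Mdl S → Prop} (hC : SyzClosed C) {M : Mdl S} (hM : C M) :
    IsGP M := by
  obtain ⟨W, hW0, hWC, hWr⟩ := exists_int_chain C SyzRel hC.syz hC.cosyz M hM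
  have key : ∀ j : ℤ, ∃ P : Mdl S, FGProj P ∧ ∃ (ι : (W (j - 1)).carrier →ₗ[S] P.carrier)
      (ρ : ∀ k, k + 1 = j → P.carrier →ₗ[S] (W (k - 1)).carrier), Injective ι ∧
      ∀ k h, Surjective (ρ k h) ∧ Exact ι (ρ k h) := by
    intro j
    obtain ⟨k, rfl⟩ : ∃ k, j = k + 1 := ⟨j - 1, by omega⟩
    have h := hWr (k - 1)
    rw [show k - 1 + 1 = k + 1 - 1 by omega] at h
    obtain ⟨P, hP, ι, π, h1, h2, h3⟩ := h
    refine ⟨P, hP, ι, fun k' hk' => (show k = k' by omega) ▸ π, h1, ?_⟩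
    intro k' hk'
    obtain rfl : k = k' := by omega
    exact ⟨h2, h3⟩
  choose P hP ι ρ hι hρ using key
  let π : ∀ i : ℤ, (P (i + 1)).carrier →ₗ[S] (W (i - 1)).carrier := fun i => ρ (i + 1) i rfl
  have hπ : ∀ i, Surjective (π i) := fun i => (hρ (i + 1) i rfl).1
  have hex : ∀ i, Exact (ι (i + 1)) (π i) := fun i => (hρ (i + 1) i rfl).2
  have hker : ∀ i, LinearMap.ker (ι i ∘ₗ π i) = LinearMap.range (ι (i + 1)) := fun i => by
    rw [LinearMap.ker_comp_of_ker_eq_bot _ (LinearMap.ker_eq_bot.2 (hι i))]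
    exact LinearMap.exact_iff.1 (hex i)
  refine ⟨P, fun i => ι i ∘ₗ π i, hP, fun i => ?_, fun Q hQ i g hg => ?_, ?_⟩
  · rw [hker, LinearMap.range_comp_of_range_eq_top _ (LinearMap.range_eq_top.2 (hπ _))]
  · have hg' : g ∘ₗ ι (i + 1) = 0 := by
      rw [← LinearMap.cancel_right (hπ (i + 1))]
      simpa [LinearMap.comp_assoc] using hg
    obtain ⟨g', hg'⟩ := exists_comp_eq_of_ker_le (π i) (hπ i) g (fun x hx => by
      obtain ⟨y, rfl⟩ := (hex i x).1 hx
      exact LinearMap.congr_fun hg' y)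
    obtain ⟨k, rfl⟩ : ∃ k, i = k + 1 := ⟨i - 1, by omega⟩
    obtain ⟨F, hF⟩ := hC.ext _ (hWC (k - 1)) Q hQ _ _ (ι (k + 1)) (π k) (hι _) (hπ _) (hex _) g'
    exact ⟨F, by rw [← LinearMap.comp_assoc, hF, hg']⟩
  · subst hW0
    exact ⟨(LinearEquiv.ofInjective (ι (0 + 1)) (hι _)).trans
      (LinearEquiv.ofEq _ _ (hker 0).symm)⟩

theorem HasSES.of_equiv_right {A B C C' : Mdl S} (e : C.carrier ≃ₗ[S] C'.carrier)
    (h : HasSES A B C) : HasSES A B C' := by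
  obtain ⟨i, p, hi, hp, hx⟩ := h
  refine ⟨i, e.toLinearMap ∘ₗ p, hi, e.surjective.comp hp, fun y => ?_⟩
  rw [← hx y]; simp

theorem HasSES.of_equiv_left {A A' B C : Mdl S} (e : A.carrier ≃ₗ[S] A'.carrier)
    (h : HasSES A B C) : HasSES A' B C := by
  obtain ⟨i, p, hi, hp, hx⟩ := h
  refine ⟨i ∘ₗ e.symm.toLinearMap, p, hi.comp e.symm.injective, hp, fun y => ?_⟩
  rw [hx y]
  constructor
  · rintro ⟨x, rfl⟩; exact ⟨e x, by simp⟩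
  · rintro ⟨x, rfl⟩; exact ⟨e.symm x, by simp⟩

theorem ExtVanishes.of_equiv {M N : Mdl S} (e : M.carrier ≃ₗ[S] N.carrier)
    (h : ExtVanishes M) : ExtVanishes N := by
  intro Q hQ A B i p hi hp hx f
  refine h Q hQ A B i (e.symm.toLinearMap ∘ₗ p) hi (e.symm.surjective.comp hp) (fun y => ?_) f
  rw [← hx y]; simp

theorem isGP_syzClosed : SyzClosed (IsGP (S := S)) := by
  have key : ∀ M : Mdl S, IsGP M → ∃ C : Mdl S → Prop, SyzClosed C ∧ C M := by
    rintro M ⟨P, d, hP, hex, htot, ⟨e⟩⟩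
    have hd : ∀ i x, d i (d (i + 1) x) = 0 := fun i x => by
      have : d (i + 1) x ∈ LinearMap.ker (d i) := hex i ▸ LinearMap.mem_range_self _ x
      simpa using this
    have hlift : ∀ i y, d i y = 0 → ∃ x, d (i + 1) x = y := fun i y hy => by
      have : y ∈ LinearMap.range (d (i + 1)) := (hex i).symm ▸ hy
      exact this
    have hrel : ∀ i, SyzRel (Mdl.of S (LinearMap.ker (d (i + 1))))
        (Mdl.of S (LinearMap.ker (d i))) := fun i => by
      refine ⟨P (i + 1 + 1), hP _, (LinearMap.ker (d (i + 1))).subtype,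
        (d (i + 1)).codRestrict _ (hd i), Subtype.val_injective, ?_, ?_⟩
      · rintro ⟨y, hy⟩
        obtain ⟨x, rfl⟩ := hlift i y hy
        exact ⟨x, rfl⟩
      · intro y
        constructor
        · intro h; exact ⟨⟨y, congrArg Subtype.val h⟩, rfl⟩
        · rintro ⟨x, rfl⟩; exact Subtype.ext x.2
    have hext : ∀ i, ExtVanishes (Mdl.of S (LinearMap.ker (d i))) := by
      intro i Q hQ A B j p hj hp hx f
      have := (hP (i + 1 + 1)).1
      let π : (P (i + 1 + 1)).carrier →ₗ[S] (Mdl.of S (LinearMap.ker (d i))).carrier :=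
        (d (i + 1)).codRestrict _ (hd i)
      obtain ⟨s, hs⟩ := Module.projective_lifting_property p π hp
      have hs' : ∀ x, p (s x) = π x := LinearMap.congr_fun hs
      obtain ⟨t, ht⟩ := exists_comp_eq_of_range_le j hj (s ∘ₗ d (i + 1 + 1)) (fun x => by
        refine (hx _).1 ?_
        simp only [LinearMap.comp_apply, hs']
        exact Subtype.ext (hd _ x))
      have ht' : ∀ x, j (t x) = s (d (i + 1 + 1) x) := LinearMap.congr_fun ht
      obtain ⟨h, hh⟩ := htot Q hQ (i + 1 + 1) (f ∘ₗ t) (by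
        ext x
        have : t (d (i + 1 + 1 + 1) x) = 0 := hj (by rw [ht', hd, map_zero, map_zero])
        simp [this])
      obtain ⟨F, hF⟩ := exists_comp_eq_of_ker_le (j.coprod s) (fun b => by
        obtain ⟨x, hx'⟩ := hlift i _ (p b).2
        have h0 : p (b - s x) = 0 := by
          rw [map_sub, hs', sub_eq_zero]; exact Subtype.ext hx'.symm
        obtain ⟨a, ha⟩ := (hx _).1 h0
        exact ⟨(a, x), by simp [ha]⟩) (f.coprod h) (by
        rintro ⟨a, x⟩ h0
        simp only [LinearMap.coprod_apply] at h0 ⊢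
        have h1 : π x = 0 := by
          have := congrArg p h0
          rwa [map_add, (hx _).2 ⟨a, rfl⟩, zero_add, hs', map_zero] at this
        obtain ⟨y, rfl⟩ := hlift (i + 1) x (congrArg Subtype.val h1)
        rw [← ht', ← map_add] at h0
        have h2 : a + t y = 0 := hj (by rw [h0, map_zero])
        rw [← LinearMap.comp_apply h, hh, LinearMap.comp_apply, ← map_add, h2, map_zero])
      refine ⟨F, ?_⟩
      ext a
      simpa using LinearMap.congr_fun hF (a, 0)
    refine ⟨fun N => ∃ i, Nonempty (LinearMap.ker (d i) ≃ₗ[S] N.carrier), ⟨?_, ?_, ?_⟩,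
      0, ⟨e.symm⟩⟩
    · rintro N ⟨i, ⟨e⟩⟩
      obtain ⟨Q, hQ, h⟩ := hrel i
      exact ⟨_, ⟨i + 1, ⟨LinearEquiv.refl _ _⟩⟩, Q, hQ, h.of_equiv_right e⟩
    · rintro N ⟨i, ⟨e⟩⟩
      obtain ⟨k, rfl⟩ : ∃ k, i = k + 1 := ⟨i - 1, by omega⟩
      obtain ⟨Q, hQ, h⟩ := hrel k
      exact ⟨_, ⟨k, ⟨LinearEquiv.refl _ _⟩⟩, Q, hQ, h.of_equiv_left e⟩
    · rintro N ⟨i, ⟨e⟩⟩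
      exact (hext i).of_equiv e
  refine ⟨fun M hM => ?_, fun M hM => ?_, fun M hM => ?_⟩ <;> obtain ⟨C, hC, hCM⟩ := key M hM
  · obtain ⟨K, hK, h⟩ := hC.syz M hCM
    exact ⟨K, hC.isGP hK, h⟩
  · obtain ⟨K, hK, h⟩ := hC.cosyz M hCM
    exact ⟨K, hC.isGP hK, h⟩
  · exact hC.ext M hCM


theorem exists_equiv_ker {A B C : Type} [AddCommGroup A] [AddCommGroup B] [AddCommGroup C]
    [Module S A] [Module S B] [Module S C] (i : A →ₗ[S] B) (p : B →ₗ[S] C) (hi : Injective i)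
    (h : Exact i p) : Nonempty (A ≃ₗ[S] LinearMap.ker p) :=
  ⟨(LinearEquiv.ofInjective i hi).trans (LinearEquiv.ofEq _ _ (LinearMap.exact_iff.1 h).symm)⟩

theorem exists_quotient_equiv {A B C : Type} [AddCommGroup A] [AddCommGroup B] [AddCommGroup C]
    [Module S A] [Module S B] [Module S C] (i : A →ₗ[S] B) (p : B →ₗ[S] C) (hp : Surjective p)
    (h : Exact i p) : Nonempty ((B ⧸ LinearMap.range i) ≃ₗ[S] C) :=
  ⟨(Submodule.quotEquivOfEq _ _ (LinearMap.exact_iff.1 h).symm).trans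
    (p.quotKerEquivOfSurjective hp)⟩

theorem IsGP.exists_cover {M : Mdl S} (h : IsGP M) :
    ∃ (P : Mdl S) (q : P.carrier →ₗ[S] M.carrier), FGProj P ∧ Surjective q ∧
      IsGP (Mdl.of S (LinearMap.ker q)) := by
  obtain ⟨K, hK, P, hP, i, p, hi, hp, hx⟩ := isGP_syzClosed.syz M h
  obtain ⟨e⟩ := exists_equiv_ker i p hi hx
  exact ⟨P, p, hP, hp, isGP_of_equiv e hK⟩

theorem IsGP.exists_hull {M : Mdl S} (h : IsGP M) :
    ∃ (P : Mdl S) (q : M.carrier →ₗ[S] P.carrier), FGProj P ∧ Injective q ∧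
      IsGP (Mdl.of S (P.carrier ⧸ LinearMap.range q)) := by
  obtain ⟨K, hK, P, hP, i, p, hi, hp, hx⟩ := isGP_syzClosed.cosyz M h
  obtain ⟨e⟩ := exists_quotient_equiv i p hp hx
  exact ⟨P, i, hP, hi, isGP_of_equiv e.symm hK⟩

theorem FGProj.isGP {P : Mdl S} (h : FGProj P) : IsGP P := by
  have h0 : FGProj (Mdl.of S PUnit) :=
    ⟨inferInstanceAs (Module.Projective S PUnit), inferInstanceAs (Module.Finite S PUnit)⟩
  refine SyzClosed.isGP (C := FGProj) ⟨fun M hM => ?_, fun M hM => ?_, fun M hM => ?_⟩ h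
  · refine ⟨_, h0, M, hM, 0, LinearMap.id, fun _ _ _ => rfl, surjective_id, fun y => ?_⟩
    exact ⟨fun hy => ⟨0, hy.symm⟩, fun ⟨x, hx⟩ => hx.symm⟩
  · exact ⟨_, h0, M, hM, LinearMap.id, 0, injective_id, fun _ => ⟨0, rfl⟩,
      fun y => ⟨fun _ => ⟨y, rfl⟩, fun _ => rfl⟩⟩
  · intro Q hQ A B i p hi hp hx f
    have := hM.1
    obtain ⟨s, hs⟩ := Module.projective_lifting_property p LinearMap.id hp
    have hs' : ∀ x, p (s x) = x := LinearMap.congr_fun hs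
    obtain ⟨t, ht⟩ := exists_comp_eq_of_range_le i hi (LinearMap.id - s ∘ₗ p)
      (fun b => (hx _).1 (by simp [hs']))
    refine ⟨f ∘ₗ t, ?_⟩
    ext a
    have h1 : i (t (i a)) = i a := by
      have := LinearMap.congr_fun ht (i a)
      simpa [hx.apply_apply_eq_zero] using this
    simp [hi h1]

theorem ExtVanishes.of_hasSES {X M Y : Mdl S} (h : HasSES X M Y) (hX : ExtVanishes X)
    (hY : ExtVanishes Y) : ExtVanishes M := by
  obtain ⟨i, p, hi, hp, hx⟩ := h
  intro Q hQ A B j r hj hr hx' f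
  have hpr : ∀ b, p (r b) = 0 → ∃ x, i x = r b := fun b hb => (hx _).1 hb
  let B' : Mdl S := Mdl.of S (LinearMap.ker (p ∘ₗ r))
  obtain ⟨r', hr'⟩ : ∃ r' : B'.carrier →ₗ[S] X.carrier,
      i ∘ₗ r' = r ∘ₗ (LinearMap.ker (p ∘ₗ r)).subtype :=
    exists_comp_eq_of_range_le i hi (r ∘ₗ (LinearMap.ker (p ∘ₗ r)).subtype) (fun b => hpr _ b.2)
  have hr'' : ∀ b : B'.carrier, i (r' b) = r b.1 := LinearMap.congr_fun hr'
  let j' : A.carrier →ₗ[S] B'.carrier := j.codRestrict _ (fun a => by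
    simp [hx'.apply_apply_eq_zero])
  obtain ⟨F, hF⟩ := hX Q hQ A B' j' r' (fun a b hab => hj (congrArg Subtype.val hab))
    (fun x => by
      obtain ⟨b, hb⟩ := hr (i x)
      exact ⟨⟨b, by simp [hb, hx.apply_apply_eq_zero]⟩, hi ((hr'' _).trans hb)⟩)
    (fun b => by
      constructor
      · intro hb
        obtain ⟨a, ha⟩ := (hx' b.1).1 ((hr'' b).symm.trans (by rw [hb, map_zero]))
        exact ⟨a, Subtype.ext ha⟩
      · rintro ⟨a, rfl⟩
        refine hi ?_
        rw [hr'', map_zero]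
        exact hx'.apply_apply_eq_zero a) f
  obtain ⟨G, hG⟩ := hY Q hQ B' B (LinearMap.ker (p ∘ₗ r)).subtype (p ∘ₗ r)
    Subtype.val_injective (hp.comp hr) (LinearMap.exact_subtype_ker_map _) F
  refine ⟨G, ?_⟩
  rw [← hF, ← hG]; rfl

theorem hasSES_ker_of_comm {X M Y X' M' Y' : Mdl S}
    {i : X.carrier →ₗ[S] M.carrier} {p : M.carrier →ₗ[S] Y.carrier}
    {i' : X'.carrier →ₗ[S] M'.carrier} {p' : M'.carrier →ₗ[S] Y'.carrier}
    (hi : Injective i) (hx : Exact i p)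
    (hi' : Injective i') (hp' : Surjective p') (hx' : Exact i' p')
    {u : X'.carrier →ₗ[S] X.carrier} {v : M'.carrier →ₗ[S] M.carrier}
    {w : Y'.carrier →ₗ[S] Y.carrier} (hu : Surjective u)
    (h1 : v ∘ₗ i' = i ∘ₗ u) (h2 : p ∘ₗ v = w ∘ₗ p') :
    HasSES (Mdl.of S (LinearMap.ker u)) (Mdl.of S (LinearMap.ker v))
      (Mdl.of S (LinearMap.ker w)) := by
  have h1' : ∀ x, v (i' x) = i (u x) := LinearMap.congr_fun h1
  have h2' : ∀ x, p (v x) = w (p' x) := LinearMap.congr_fun h2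
  refine ⟨i'.restrict (p := LinearMap.ker u) (q := LinearMap.ker v) (fun x hx => ?_),
    p'.restrict (p := LinearMap.ker v) (q := LinearMap.ker w) (fun x hx => ?_), ?_, ?_, ?_⟩
  · rw [LinearMap.mem_ker] at hx ⊢
    rw [h1', hx, map_zero]
  · rw [LinearMap.mem_ker] at hx ⊢
    rw [← h2', hx, map_zero]
  · exact fun a b hab => Subtype.ext (hi' (congrArg Subtype.val hab))
  · rintro ⟨y, hy⟩
    obtain ⟨e, rfl⟩ := hp' y
    obtain ⟨x, hx1⟩ := (hx (v e)).1 (by rw [h2']; exact hy)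
    obtain ⟨e', rfl⟩ := hu x
    refine ⟨⟨e - i' e', ?_⟩, Subtype.ext ?_⟩
    · rw [LinearMap.mem_ker, map_sub, h1', hx1, sub_self]
    · change p' (e - i' e') = p' e
      rw [map_sub, hx'.apply_apply_eq_zero, sub_zero]
  · rintro ⟨y, hy⟩
    constructor
    · intro h
      obtain ⟨x, rfl⟩ := (hx' y).1 (congrArg Subtype.val h)
      refine ⟨⟨x, hi ?_⟩, rfl⟩
      rw [← h1', map_zero]; exact hy
    · rintro ⟨x, h⟩
      refine Subtype.ext ?_
      change p' y = 0
      rw [← show i' x.1 = y from congrArg Subtype.val h, hx'.apply_apply_eq_zero]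

theorem shortExact_coker_of_comm {X M Y X' M' Y' : Mdl S}
    {i : X.carrier →ₗ[S] M.carrier} {p : M.carrier →ₗ[S] Y.carrier}
    {i' : X'.carrier →ₗ[S] M'.carrier} {p' : M'.carrier →ₗ[S] Y'.carrier}
    (hp : Surjective p) (hx : Exact i p)
    (hi' : Injective i') (hp' : Surjective p') (hx' : Exact i' p')
    {X'' M'' Y'' : Mdl S}
    {u : X.carrier →ₗ[S] X'.carrier} {v : M.carrier →ₗ[S] M'.carrier}
    {w : Y.carrier →ₗ[S] Y'.carrier} (hw : Injective w)
    (h1 : v ∘ₗ i = i' ∘ₗ u) (h2 : p' ∘ₗ v = w ∘ₗ p)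
    {u' : X'.carrier →ₗ[S] X''.carrier} {v' : M'.carrier →ₗ[S] M''.carrier}
    {w' : Y'.carrier →ₗ[S] Y''.carrier} (hu' : Surjective u') (hv' : Surjective v')
    (hw' : Surjective w') (hu : Exact u u') (hv : Exact v v') (hww : Exact w w')
    {i'' : X''.carrier →ₗ[S] M''.carrier} {p'' : M''.carrier →ₗ[S] Y''.carrier}
    (h3 : i'' ∘ₗ u' = v' ∘ₗ i') (h4 : p'' ∘ₗ v' = w' ∘ₗ p') :
    Injective i'' ∧ Surjective p'' ∧ Exact i'' p'' := by
  have h1' : ∀ x, v (i x) = i' (u x) := LinearMap.congr_fun h1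
  have h2' : ∀ x, p' (v x) = w (p x) := LinearMap.congr_fun h2
  have h3' : ∀ x, i'' (u' x) = v' (i' x) := LinearMap.congr_fun h3
  have h4' : ∀ x, p'' (v' x) = w' (p' x) := LinearMap.congr_fun h4
  refine ⟨?_, ?_, ?_⟩
  · rw [injective_iff_map_eq_zero]
    intro x hx0
    obtain ⟨x, rfl⟩ := hu' x
    obtain ⟨m, hm⟩ := (hv _).1 ((h3' x).symm.trans hx0)
    obtain ⟨x', rfl⟩ := (hx m).1 (hw (by rw [← h2', hm, hx'.apply_apply_eq_zero, map_zero]))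
    rw [h1'] at hm
    rw [← hi' hm, hu.apply_apply_eq_zero]
  · intro y
    obtain ⟨y, rfl⟩ := hw' y
    obtain ⟨m, rfl⟩ := hp' y
    exact ⟨v' m, h4' m⟩
  · intro m
    obtain ⟨m, rfl⟩ := hv' m
    constructor
    · intro hm
      rw [h4'] at hm
      obtain ⟨y, hy⟩ := (hww _).1 hm
      obtain ⟨n, rfl⟩ := hp y
      obtain ⟨x, hx1⟩ := (hx' (m - v n)).1 (by rw [map_sub, h2', hy, sub_self])
      exact ⟨u' x, by rw [h3', hx1, map_sub, hv.apply_apply_eq_zero, sub_zero]⟩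
    · rintro ⟨x, hx1⟩
      obtain ⟨x, rfl⟩ := hu' x
      rw [← hx1, h3', h4', hx'.apply_apply_eq_zero, map_zero]

theorem FGProj.prod {P Q : Mdl S} (hP : FGProj P) (hQ : FGProj Q) :
    FGProj (Mdl.of S (P.carrier × Q.carrier)) := by
  have := hP.1
  have := hP.2
  have := hQ.1
  have := hQ.2
  exact ⟨inferInstanceAs (Module.Projective S (P.carrier × Q.carrier)),
    inferInstanceAs (Module.Finite S (P.carrier × Q.carrier))⟩

/-- Gorenstein projective modules are closed under extensions. -/
theorem IsGP.of_hasSES {X M Y : Mdl S} (h : HasSES X M Y) (hX : IsGP X) (hY : IsGP Y) :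
    IsGP M := by
  refine SyzClosed.isGP (C := fun M => ∃ X Y, HasSES X M Y ∧ IsGP X ∧ IsGP Y)
    ⟨?_, ?_, ?_⟩ ⟨X, Y, h, hX, hY⟩
  · rintro M ⟨X, Y, ⟨i, p, hi, hp, hx⟩, hX, hY⟩
    obtain ⟨P, q, hP, hq, hK⟩ := hX.exists_cover
    obtain ⟨P', q', hP', hq', hK'⟩ := hY.exists_cover
    have := hP'.1
    obtain ⟨s, hs⟩ := Module.projective_lifting_property p q' hp
    have hs' : ∀ x, p (s x) = q' x := LinearMap.congr_fun hs
    let u : (Mdl.of S (P.carrier × P'.carrier)).carrier →ₗ[S] M.carrier := (i ∘ₗ q).coprod s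
    have hu : ∀ x y, u (x, y) = i (q x) + s y := fun x y => rfl
    refine ⟨Mdl.of S (LinearMap.ker u), ⟨_, _, ?_, hK, hK'⟩, _, hP.prod hP',
      hasSES_ker u fun m => ?_⟩
    · exact hasSES_ker_of_comm (M' := Mdl.of S (P.carrier × P'.carrier)) (i := i) (p := p)
        (i' := LinearMap.inl S P.carrier P'.carrier) (p' := LinearMap.snd S P.carrier P'.carrier)
        hi hx LinearMap.inl_injective LinearMap.snd_surjective (.inl_snd) hq
        (LinearMap.ext fun x => by
          change u (x, 0) = i (q x)
          rw [hu, map_zero, add_zero])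
        (LinearMap.ext fun x => by
          change p (i (q x.1) + s x.2) = q' x.2
          rw [map_add, hx.apply_apply_eq_zero, zero_add, hs'])
    · obtain ⟨y, hy⟩ := hq' (p m)
      obtain ⟨x, hx1⟩ := (hx (m - s y)).1 (by rw [map_sub, hs', hy, sub_self])
      obtain ⟨x, rfl⟩ := hq x
      exact ⟨(x, y), by rw [hu, hx1, sub_add_cancel]⟩
  · rintro M ⟨X, Y, ⟨i, p, hi, hp, hx⟩, hX, hY⟩
    obtain ⟨P, q, hP, hq, hK⟩ := hX.exists_hull
    obtain ⟨P', q', hP', hq', hK'⟩ := hY.exists_hull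
    obtain ⟨t, ht⟩ := isGP_syzClosed.ext Y hY P hP.1 X M i p hi hp hx q
    have ht' : ∀ x, t (i x) = q x := LinearMap.congr_fun ht
    let u : M.carrier →ₗ[S] (Mdl.of S (P.carrier × P'.carrier)).carrier := t.prod (q' ∘ₗ p)
    have hu : ∀ m, u m = (t m, q' (p m)) := fun m => rfl
    have hui : Injective u := by
      rw [injective_iff_map_eq_zero]
      intro m hm
      have h1 : t m = 0 := congrArg Prod.fst hm
      have h2 : q' (p m) = 0 := congrArg Prod.snd hm
      obtain ⟨x, rfl⟩ := (hx m).1 (hq' (h2.trans (map_zero q').symm))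
      rw [ht'] at h1
      rw [hq (h1.trans (map_zero q).symm), map_zero]
    have h1 : u ∘ₗ i = LinearMap.inl S P.carrier P'.carrier ∘ₗ q := LinearMap.ext fun x => by
      change (t (i x), q' (p (i x))) = (q x, 0)
      rw [ht', hx.apply_apply_eq_zero, map_zero]
    have h1' : ∀ x, u (i x) = (q x, 0) := LinearMap.congr_fun h1
    let u' : (Mdl.of S (P.carrier × P'.carrier)).carrier →ₗ[S]
      (Mdl.of S ((Mdl.of S (P.carrier × P'.carrier)).carrier ⧸ LinearMap.range u)).carrier :=
      (LinearMap.range u).mkQ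
    have hu' : Exact u u' := LinearMap.exact_map_mkQ_range u
    obtain ⟨i'', hi''⟩ := exists_comp_eq_of_ker_le (LinearMap.range q).mkQ
      (Submodule.mkQ_surjective _) (u' ∘ₗ LinearMap.inl S P.carrier P'.carrier) (fun x hx0 => by
        obtain ⟨y, rfl⟩ := (LinearMap.exact_map_mkQ_range q x).1 hx0
        exact (hu' _).2 ⟨i y, h1' y⟩)
    obtain ⟨p'', hp''⟩ := exists_comp_eq_of_ker_le u' (Submodule.mkQ_surjective _)
      ((LinearMap.range q').mkQ ∘ₗ LinearMap.snd S P.carrier P'.carrier) (fun x hx0 => by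
        obtain ⟨y, rfl⟩ := (hu' x).1 hx0
        exact (LinearMap.exact_map_mkQ_range q').apply_apply_eq_zero (p y))
    refine ⟨_, ⟨_, _, ⟨i'', p'', ?_⟩, hK, hK'⟩, _, hP.prod hP', hasSES_coker u hui⟩
    exact shortExact_coker_of_comm (M' := Mdl.of S (P.carrier × P'.carrier))
      (X'' := Mdl.of S _) (Y'' := Mdl.of S _) hp hx LinearMap.inl_injective
      LinearMap.snd_surjective (.inl_snd) hq' h1 rfl
      (Submodule.mkQ_surjective _) (Submodule.mkQ_surjective _) (Submodule.mkQ_surjective _)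
      (LinearMap.exact_map_mkQ_range q) hu' (LinearMap.exact_map_mkQ_range q') hi'' hp''
  · rintro M ⟨X, Y, h, hX, hY⟩
    exact .of_hasSES h (isGP_syzClosed.ext X hX) (isGP_syzClosed.ext Y hY)

theorem isGP_of_syz_of_cosyz {K M N : Mdl S} (h1 : SyzRel K M) (hK : IsGP K)
    (h2 : SyzRel M N) (hN : IsGP N) (hM : ExtVanishes M) : IsGP M := by
  refine SyzClosed.isGP (C := fun L => IsGP L ∨ L = M) ⟨?_, ?_, ?_⟩ (Or.inr rfl)
  · rintro L (hL | rfl)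
    · obtain ⟨K, hK, h⟩ := isGP_syzClosed.syz L hL
      exact ⟨K, Or.inl hK, h⟩
    · exact ⟨K, Or.inl hK, h1⟩
  · rintro L (hL | rfl)
    · obtain ⟨K, hK, h⟩ := isGP_syzClosed.cosyz L hL
      exact ⟨K, Or.inl hK, h⟩
    · exact ⟨N, Or.inl hN, h2⟩
  · rintro L (hL | rfl)
    · exact isGP_syzClosed.ext L hL
    · exact hM

theorem ExtVanishes.of_retract {E K : Mdl S} (hE : ExtVanishes E)
    (t : E.carrier →ₗ[S] K.carrier) (σ : K.carrier →ₗ[S] E.carrier) (h : t ∘ₗ σ = LinearMap.id) :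
    ExtVanishes K := by
  have h' : ∀ x, t (σ x) = x := LinearMap.congr_fun h
  intro Q hQ A B i p hi hp hx f
  let v : B.carrier × E.carrier →ₗ[S] K.carrier := p.coprod (-t)
  have hv : ∀ b e, v (b, e) = p b - t e := fun b e => (sub_eq_add_neg _ _).symm
  let B' : Mdl S := Mdl.of S (LinearMap.ker v)
  let i' : A.carrier →ₗ[S] B'.carrier :=
    (LinearMap.inl S B.carrier E.carrier ∘ₗ i).codRestrict _ (fun a => by
      change v (i a, 0) = 0
      rw [hv, hx.apply_apply_eq_zero, map_zero, sub_zero])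
  let g : B.carrier →ₗ[S] B'.carrier := (LinearMap.id.prod (σ ∘ₗ p)).codRestrict _ (fun b => by
    change v (b, σ (p b)) = 0
    rw [hv, h', sub_self])
  obtain ⟨F, hF⟩ := hE Q hQ A B' i' (LinearMap.snd S _ _ ∘ₗ (LinearMap.ker v).subtype)
    (fun a b hab => hi (congrArg (fun z : B'.carrier => z.1.1) hab))
    (fun e => by
      obtain ⟨b, hb⟩ := hp (t e)
      exact ⟨⟨(b, e), (hv b e).trans (sub_eq_zero.2 hb)⟩, rfl⟩)
    (fun z => by
      obtain ⟨⟨b, e⟩, hz⟩ := z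
      constructor
      · rintro (rfl : e = 0)
        obtain ⟨a, rfl⟩ := (hx b).1 (by simpa [hv] using hz)
        exact ⟨a, rfl⟩
      · rintro ⟨a, ha⟩
        exact (congrArg (fun z : B'.carrier => z.1.2) ha).symm) f
  refine ⟨F ∘ₗ g, ?_⟩
  rw [← hF, LinearMap.comp_assoc]
  congr 1
  ext a
  refine Subtype.ext (Prod.ext rfl ?_)
  change σ (p (i a)) = 0
  rw [hx.apply_apply_eq_zero, map_zero]

/-- Gorenstein projective modules are closed under kernels of epimorphisms. -/
theorem IsGP.ker {M Y : Mdl S} (p : M.carrier →ₗ[S] Y.carrier) (hp : Surjective p)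
    (hM : IsGP M) (hY : IsGP Y) : IsGP (Mdl.of S (LinearMap.ker p)) := by
  let K : Mdl S := Mdl.of S (LinearMap.ker p)
  obtain ⟨P, q, hP, hq, hL⟩ := hY.exists_cover
  have := hP.1
  obtain ⟨s, hs⟩ := Module.projective_lifting_property p q hp
  have hs' : ∀ x, p (s x) = q x := LinearMap.congr_fun hs
  let v : M.carrier × P.carrier →ₗ[S] Y.carrier := p.coprod (-q)
  have hv : ∀ m x, v (m, x) = p m - q x := fun b e => (sub_eq_add_neg _ _).symm
  have hv0 : ∀ z : LinearMap.ker v, p z.1.1 = q z.1.2 := fun z =>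
    sub_eq_zero.1 ((hv z.1.1 z.1.2).symm.trans z.2)
  let E : Mdl S := Mdl.of S (LinearMap.ker v)
  have hE : IsGP E := by
    refine IsGP.of_hasSES ⟨?_, ?_, ?_, ?_, ?_⟩ hL hM
    · exact (LinearMap.inr S M.carrier P.carrier ∘ₗ (LinearMap.ker q).subtype).codRestrict _
        fun l => by
          change v (0, l.1) = 0
          rw [hv, map_zero, show q l.1 = 0 from l.2, sub_zero]
    · exact LinearMap.fst S _ _ ∘ₗ (LinearMap.ker v).subtype
    · exact fun a b hab => Subtype.ext (congrArg (fun z : E.carrier => z.1.2) hab)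
    · intro m
      obtain ⟨x, hx⟩ := hq (p m)
      exact ⟨⟨(m, x), (hv m x).trans (sub_eq_zero.2 hx.symm)⟩, rfl⟩
    · rintro ⟨⟨m, x⟩, hz⟩
      constructor
      · rintro (rfl : m = 0)
        exact ⟨⟨x, by simpa [hv] using hz⟩, rfl⟩
      · rintro ⟨a, ha⟩
        exact (congrArg (fun z : E.carrier => z.1.1) ha).symm
  let t : E.carrier →ₗ[S] K.carrier :=
    ((LinearMap.fst S M.carrier P.carrier - s ∘ₗ LinearMap.snd S M.carrier P.carrier) ∘ₗ
      (LinearMap.ker v).subtype).codRestrict _ fun z => by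
        change p (z.1.1 - s z.1.2) = 0
        rw [map_sub, hs', hv0, sub_self]
  let σ : K.carrier →ₗ[S] E.carrier :=
    (LinearMap.inl S M.carrier P.carrier ∘ₗ (LinearMap.ker p).subtype).codRestrict _ fun k => by
      change v (k.1, 0) = 0
      rw [hv, map_zero, sub_zero]; exact k.2
  have hσ : t ∘ₗ σ = LinearMap.id := LinearMap.ext fun k => Subtype.ext (by
    change k.1 - s 0 = k.1
    rw [map_zero, sub_zero])
  have hts : Surjective t := fun k => ⟨σ k, LinearMap.congr_fun hσ k⟩
  obtain ⟨P', q', hP', hq', hL'⟩ := hE.exists_cover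
  obtain ⟨P'', r, hP'', hr, hN⟩ := hM.exists_hull
  have hri : Injective (r ∘ₗ (LinearMap.ker p).subtype) := hr.comp Subtype.val_injective
  refine isGP_of_syz_of_cosyz (K := Mdl.of S (LinearMap.ker (t ∘ₗ q')))
    (N := Mdl.of S (P''.carrier ⧸ LinearMap.range (r ∘ₗ (LinearMap.ker p).subtype)))
    ⟨P', hP', hasSES_ker (B := K) (t ∘ₗ q') (hts.comp hq')⟩ ?_
    ⟨P'', hP'', hasSES_coker (A := K) _ hri⟩ ?_
    ((isGP_syzClosed.ext E hE).of_retract t σ hσ)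
  · refine IsGP.of_hasSES ⟨?_, ?_, ?_, ?_, ?_⟩ hL' hP.isGP
    · exact Submodule.inclusion fun x hx => by
        rw [LinearMap.mem_ker] at hx ⊢
        rw [LinearMap.comp_apply, hx, map_zero]
    · exact LinearMap.snd S M.carrier P.carrier ∘ₗ (LinearMap.ker v).subtype ∘ₗ q' ∘ₗ
        (LinearMap.ker (t ∘ₗ q')).subtype
    · exact Submodule.inclusion_injective _
    · intro x
      obtain ⟨z, hz⟩ := hq' ⟨(s x, x), (hv _ _).trans (sub_eq_zero.2 (hs' x))⟩
      refine ⟨⟨z, ?_⟩, ?_⟩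
      · rw [LinearMap.mem_ker, LinearMap.comp_apply, hz]
        exact Subtype.ext (sub_self _)
      · change (q' z).1.2 = x
        rw [hz]
    · rintro ⟨z, hz⟩
      have hz' : (q' z).1.1 = s (q' z).1.2 := sub_eq_zero.1 (congrArg Subtype.val hz)
      constructor
      · intro (h : (q' z).1.2 = 0)
        refine ⟨⟨z, Subtype.ext (Prod.ext ?_ h)⟩, rfl⟩
        rw [hz', h, map_zero]; rfl
      · rintro ⟨a, ha⟩
        have ha' : a.1 = z := congrArg Subtype.val ha
        change (q' z).1.2 = 0
        rw [← ha', show q' a.1 = 0 from a.2]; rfl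
  · let D : Mdl S := Mdl.of S (P''.carrier ⧸ LinearMap.range (r ∘ₗ (LinearMap.ker p).subtype))
    let N : Mdl S := Mdl.of S (P''.carrier ⧸ LinearMap.range r)
    let u : P''.carrier →ₗ[S] D.carrier :=
      (LinearMap.range (r ∘ₗ (LinearMap.ker p).subtype)).mkQ
    let π : P''.carrier →ₗ[S] N.carrier := (LinearMap.range r).mkQ
    have hπs : Surjective π := Submodule.mkQ_surjective _
    have hπ : Exact r π := LinearMap.exact_map_mkQ_range r
    have hus : Surjective u := Submodule.mkQ_surjective _
    have hu : Exact (r ∘ₗ (LinearMap.ker p).subtype) u := LinearMap.exact_map_mkQ_range _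
    obtain ⟨i, hi⟩ := exists_comp_eq_of_ker_le p hp (u ∘ₗ r)
      (fun x hx => (hu _).2 ⟨⟨x, hx⟩, rfl⟩)
    have hi' : ∀ m, i (p m) = u (r m) := LinearMap.congr_fun hi
    obtain ⟨w, hw⟩ := exists_comp_eq_of_ker_le u hus π (fun x hx => by
      obtain ⟨k, rfl⟩ := (hu x).1 hx
      exact hπ.apply_apply_eq_zero k.1)
    have hw' : ∀ x, w (u x) = π x := LinearMap.congr_fun hw
    refine IsGP.of_hasSES ⟨i, w, ?_, ?_, ?_⟩ hY hN
    · rw [injective_iff_map_eq_zero]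
      intro y hy
      obtain ⟨m, rfl⟩ := hp y
      rw [hi'] at hy
      obtain ⟨k, hk⟩ := (hu _).1 hy
      rw [← hr hk]; exact k.2
    · intro y
      obtain ⟨x, rfl⟩ := hπs y
      exact ⟨u x, hw' x⟩
    · intro y
      obtain ⟨x, rfl⟩ := hus y
      rw [hw', hπ x]
      constructor
      · rintro ⟨m, rfl⟩
        exact ⟨p m, hi' m⟩
      · rintro ⟨y, hy⟩
        obtain ⟨m, rfl⟩ := hp y
        rw [hi'] at hy
        obtain ⟨k, hk⟩ := (hu (x - r m)).1 (by rw [map_sub, hy, sub_self])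
        refine ⟨m + k.1, ?_⟩
        rw [map_add, show r k.1 = x - r m from hk, add_sub_cancel]

end ShortExactSequences


section CokernelFunctor

variable {R : Type} [CommRing R]

/-- A short exact sequence `0 → K → M → N → 0`, relating its monomorphism `K → M` to the
cokernel object `M → N`. -/
structure SESData (R : Type) [CommRing R] where
  K : Mdl R
  M : Mdl R
  N : Mdl R
  i : K.carrier →ₗ[R] M.carrier
  p : M.carrier →ₗ[R] N.carrier
  inj : Injective i
  surj : Surjective p
  exact : Exact i p

namespace SESData

/-- The monomorphism of a short exact sequence. -/
def sub (X : SESData R) : MObj R := ⟨X.K, X.M, X.i⟩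

/-- The epimorphism of a short exact sequence. -/
def quo (X : SESData R) : MObj R := ⟨X.M, X.N, X.p⟩

/-- The cokernel sequence of a monomorphism. -/
def ofMono (x : MObj R) (h : Injective x.map) : SESData R :=
  ⟨x.dom, x.cod, CokMod x, x.map, (LinearMap.range x.map).mkQ, h, Submodule.mkQ_surjective _,
    LinearMap.exact_map_mkQ_range _⟩

/-- The kernel sequence of an epimorphism. -/
def ofEpi (x : MObj R) (h : Surjective x.map) : SESData R :=
  ⟨Mdl.of R (LinearMap.ker x.map), x.dom, x.cod, (LinearMap.ker x.map).subtype, x.map,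
    Subtype.val_injective, h, LinearMap.exact_subtype_ker_map _⟩

variable {X Y Z : SESData R}

theorem inG_sub_iff : InG X.sub ↔ InE X.quo := by
  obtain ⟨e⟩ := exists_quotient_equiv X.i X.p X.surj X.exact
  constructor
  · rintro ⟨-, hK, hN⟩
    have hN' : IsGP X.N := isGP_of_equiv (M := CokMod X.sub) e hN
    exact ⟨⟨IsGP.of_hasSES ⟨X.i, X.p, X.inj, X.surj, X.exact⟩ hK hN', hN'⟩, X.surj⟩
  · rintro ⟨⟨hM, hN⟩, -⟩
    obtain ⟨e'⟩ := exists_equiv_ker X.i X.p X.inj X.exact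
    exact ⟨X.inj, isGP_of_equiv e'.symm (IsGP.ker X.p X.surj hM hN),
      isGP_of_equiv (N := CokMod X.sub) e.symm hN⟩

theorem exists_quo_hom (θ : MHom X.sub Y.sub) : ∃ θ' : MHom X.quo Y.quo, θ'.h1 = θ.h2 := by
  have hc : ∀ x, Y.i (θ.h1 x) = θ.h2 (X.i x) := LinearMap.congr_fun θ.comm
  obtain ⟨w, hw⟩ := exists_comp_eq_of_ker_le X.p X.surj (Y.p ∘ₗ θ.h2) (fun x hx => by
    obtain ⟨k, rfl⟩ := (X.exact x).1 hx
    exact (congrArg Y.p (hc k)).symm.trans (Y.exact.apply_apply_eq_zero _))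
  exact ⟨⟨θ.h2, w, hw.symm⟩, rfl⟩

theorem exists_sub_hom (θ' : MHom X.quo Y.quo) : ∃ θ : MHom X.sub Y.sub, θ'.h1 = θ.h2 := by
  have hc : ∀ x, Y.p (θ'.h1 x) = θ'.h2 (X.p x) := LinearMap.congr_fun θ'.comm
  obtain ⟨w, hw⟩ := exists_comp_eq_of_range_le Y.i Y.inj (θ'.h1 ∘ₗ X.i) (fun x =>
    (Y.exact _).1 ((hc _).trans 
      ((congrArg θ'.h2 (X.exact.apply_apply_eq_zero x)).trans (map_zero θ'.h2))))
  exact ⟨⟨w, θ'.h1, hw⟩, rfl⟩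

theorem sub_comp_iff {θ : MHom X.sub Y.sub} {η : MHom Y.sub Z.sub} {ζ : MHom X.sub Z.sub} :
    (η.h1 ∘ₗ θ.h1 = ζ.h1 ∧ η.h2 ∘ₗ θ.h2 = ζ.h2) ↔ η.h2 ∘ₗ θ.h2 = ζ.h2 := by
  refine ⟨And.right, fun h => ⟨LinearMap.ext fun x => Z.inj ?_, h⟩⟩
  have hη : ∀ x, Z.i (η.h1 x) = η.h2 (Y.i x) := LinearMap.congr_fun η.comm
  have hθ : ∀ x, Y.i (θ.h1 x) = θ.h2 (X.i x) := LinearMap.congr_fun θ.comm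
  have hζ : ∀ x, Z.i (ζ.h1 x) = ζ.h2 (X.i x) := LinearMap.congr_fun ζ.comm
  exact (hη _).trans <| (congrArg η.h2 (hθ x)).trans <|
    (LinearMap.congr_fun h (X.i x)).trans (hζ x).symm

theorem quo_comp_iff {θ : MHom X.quo Y.quo} {η : MHom Y.quo Z.quo} {ζ : MHom X.quo Z.quo} :
    (η.h1 ∘ₗ θ.h1 = ζ.h1 ∧ η.h2 ∘ₗ θ.h2 = ζ.h2) ↔ η.h1 ∘ₗ θ.h1 = ζ.h1 := by
  refine ⟨And.left, fun h => ⟨h, LinearMap.ext fun n => ?_⟩⟩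
  have hη : ∀ x, Z.p (η.h1 x) = η.h2 (Y.p x) := LinearMap.congr_fun η.comm
  have hθ : ∀ x, Y.p (θ.h1 x) = θ.h2 (X.p x) := LinearMap.congr_fun θ.comm
  have hζ : ∀ x, Z.p (ζ.h1 x) = ζ.h2 (X.p x) := LinearMap.congr_fun ζ.comm
  obtain ⟨x, rfl⟩ := X.surj n
  exact (congrArg η.h2 (hθ x)).symm.trans <| (hη _).symm.trans <|
    (congrArg Z.p (LinearMap.congr_fun h x)).trans (hζ x)

theorem comp_iff {θ : MHom X.sub Y.sub} {η : MHom Y.sub Z.sub} {ζ : MHom X.sub Z.sub}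
    {θ' : MHom X.quo Y.quo} {η' : MHom Y.quo Z.quo} {ζ' : MHom X.quo Z.quo}
    (hθ : θ'.h1 = θ.h2) (hη : η'.h1 = η.h2) (hζ : ζ'.h1 = ζ.h2) :
    (η.h1 ∘ₗ θ.h1 = ζ.h1 ∧ η.h2 ∘ₗ θ.h2 = ζ.h2) ↔
      (η'.h1 ∘ₗ θ'.h1 = ζ'.h1 ∧ η'.h2 ∘ₗ θ'.h2 = ζ'.h2) := by
  rw [sub_comp_iff, quo_comp_iff, hθ, hη, hζ]
  exact Iff.rfl

/-- The identity morphism. -/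
def idHom (f : MObj R) : MHom f f := ⟨LinearMap.id, LinearMap.id, rfl⟩

theorem splitMono_iff {θ : MHom X.sub Y.sub} {θ' : MHom X.quo Y.quo} (h : θ'.h1 = θ.h2) :
    MSplitMono θ ↔ MSplitMono θ' := by
  constructor
  · rintro ⟨σ, hσ⟩
    obtain ⟨σ', hσ'⟩ := exists_quo_hom σ
    exact ⟨σ', (comp_iff (ζ := idHom X.sub) (ζ' := idHom X.quo) h hσ' rfl).1 hσ⟩
  · rintro ⟨σ', hσ⟩
    obtain ⟨σ, hσ'⟩ := exists_sub_hom σ'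
    exact ⟨σ, (comp_iff (ζ := idHom X.sub) (ζ' := idHom X.quo) h hσ' rfl).2 hσ⟩

theorem splitEpi_iff {θ : MHom X.sub Y.sub} {θ' : MHom X.quo Y.quo} (h : θ'.h1 = θ.h2) :
    MSplitEpi θ ↔ MSplitEpi θ' := by
  constructor
  · rintro ⟨σ, hσ⟩
    obtain ⟨σ', hσ'⟩ := exists_quo_hom σ
    exact ⟨σ', (comp_iff (ζ := idHom Y.sub) (ζ' := idHom Y.quo) hσ' h rfl).1 hσ⟩
  · rintro ⟨σ', hσ⟩
    obtain ⟨σ, hσ'⟩ := exists_sub_hom σ'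
    exact ⟨σ, (comp_iff (ζ := idHom Y.sub) (ζ' := idHom Y.quo) hσ' h rfl).2 hσ⟩

theorem bijective_iff {θ : MHom X.sub Y.sub} {θ' : MHom X.quo Y.quo} (h : θ'.h1 = θ.h2) :
    (Bijective θ.h1 ∧ Bijective θ.h2) ↔ (Bijective θ'.h1 ∧ Bijective θ'.h2) := by
  have hc : ∀ x, Y.i (θ.h1 x) = θ.h2 (X.i x) := LinearMap.congr_fun θ.comm
  have hc' : ∀ x, Y.p (θ.h2 x) = θ'.h2 (X.p x) := fun x =>
    (congrArg Y.p (LinearMap.congr_fun h x)).symm.trans (LinearMap.congr_fun θ'.comm x)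
  rw [h]
  constructor
  · rintro ⟨h1, h2⟩
    refine ⟨h2, ?_, fun n => ?_⟩
    · refine (injective_iff_map_eq_zero θ'.h2).2 fun n hn => ?_
      obtain ⟨x, rfl⟩ := X.surj n
      obtain ⟨k, hk⟩ := (Y.exact _).1 ((hc' x).trans hn)
      obtain ⟨k, rfl⟩ := h1.2 k
      have : X.i k = x := h2.1 ((hc k).symm.trans hk)
      rw [← this]
      exact X.exact.apply_apply_eq_zero k
    · obtain ⟨y, rfl⟩ := Y.surj n
      obtain ⟨x, rfl⟩ := h2.2 y
      exact ⟨X.p x, (hc' x).symm⟩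
  · rintro ⟨h2, h3⟩
    refine ⟨⟨fun a b hab => X.inj (h2.1 ?_), fun k => ?_⟩, h2⟩
    · exact (hc a).symm.trans ((congrArg Y.i hab).trans (hc b))
    · obtain ⟨x, hx⟩ := h2.2 (Y.i k)
      have h0 : θ'.h2 (X.p x) = 0 := by
        refine (hc' x).symm.trans ((congrArg Y.p hx).trans ?_)
        exact Y.exact.apply_apply_eq_zero k
      obtain ⟨l, rfl⟩ := (X.exact x).1 (h3.1 (h0.trans (map_zero θ'.h2).symm))
      exact ⟨l, Y.inj ((hc l).trans hx)⟩

/-- The morphism `1 - ξ`. -/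
def oneSub {f : MObj R} (ξ : MHom f f) : MHom f f :=
  ⟨LinearMap.id - ξ.h1, LinearMap.id - ξ.h2, by
    rw [LinearMap.comp_sub, LinearMap.sub_comp, ξ.comm]; rfl⟩

theorem mTrivial_iff : MTrivial X.sub ↔ MTrivial X.quo := by
  constructor
  · rintro ⟨-, h⟩
    have : Subsingleton X.M.carrier := h
    exact ⟨h, X.surj.subsingleton⟩
  · rintro ⟨h, -⟩
    have : Subsingleton X.M.carrier := h
    exact ⟨X.inj.subsingleton, h⟩

theorem mEndLocal_iff : MEndLocal X.sub ↔ MEndLocal X.quo := by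
  refine and_congr (not_congr mTrivial_iff) ⟨fun h ξ' => ?_, fun h ξ => ?_⟩
  · obtain ⟨ξ, hξ⟩ := exists_sub_hom ξ'
    refine (h ξ).imp (bijective_iff hξ).1 (bijective_iff (θ := oneSub ξ) (θ' := oneSub ξ') ?_).1
    exact congrArg (LinearMap.id - ·) hξ
  · obtain ⟨ξ', hξ⟩ := exists_quo_hom ξ
    refine (h ξ').imp (bijective_iff hξ).2 (bijective_iff (θ := oneSub ξ) (θ' := oneSub ξ') ?_).2
    exact congrArg (LinearMap.id - ·) hξ

theorem mShortExact_quo {θ : MHom X.sub Y.sub} {η : MHom Y.sub Z.sub}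
    {θ' : MHom X.quo Y.quo} {η' : MHom Y.quo Z.quo}
    (hθ : θ'.h1 = θ.h2) (hη : η'.h1 = η.h2) (h : MShortExact θ η) : MShortExact θ' η' := by
  obtain ⟨-, h2, h3, h4, h5, h6⟩ := h
  have hx1 : Exact θ.h1 η.h1 := LinearMap.exact_iff.2 h5.symm
  have hx2 : Exact θ.h2 η.h2 := LinearMap.exact_iff.2 h6.symm
  let f : X.N.carrier →ₗ[R] Y.N.carrier := θ'.h2
  let g : Y.N.carrier →ₗ[R] Z.N.carrier := η'.h2
  have hf : f ∘ₗ X.p = Y.p ∘ₗ θ.h2 := by rw [← hθ]; exact θ'.comm.symm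
  have hg : g ∘ₗ Y.p = Z.p ∘ₗ η.h2 := by rw [← hη]; exact η'.comm.symm
  obtain ⟨a, b, c⟩ := shortExact_coker_of_comm (S := R) (X := X.K) (M := Y.K) (Y := Z.K)
    (X' := X.M) (M' := Y.M) (Y' := Z.M) (X'' := X.N) (M'' := Y.N) (Y'' := Z.N)
    (u := X.i) (v := Y.i) (w := Z.i) (i'' := f) (p'' := g)
    h3 hx1 h2 h4 hx2 Z.inj θ.comm η.comm.symm X.surj Y.surj Z.surj X.exact Y.exact Z.exact
    hf hg
  rw [MShortExact, hθ, hη]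
  exact ⟨h2, a, h4, b, h6, (LinearMap.exact_iff.1 c).symm⟩

theorem isAlmostSplitIn_iff {θ : MHom X.sub Y.sub} {η : MHom Y.sub Z.sub}
    {θ' : MHom X.quo Y.quo} {η' : MHom Y.quo Z.quo}
    (hθ : θ'.h1 = θ.h2) (hη : η'.h1 = η.h2) (h : MShortExact θ η) :
    IsAlmostSplitIn InG θ η ↔ IsAlmostSplitIn InE θ' η' := by
  refine and_congr inG_sub_iff <| and_congr inG_sub_iff <| and_congr inG_sub_iff <|
    and_congr (iff_of_true h (mShortExact_quo hθ hη h)) <|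
    and_congr (not_congr (splitMono_iff hθ)) <| and_congr mEndLocal_iff
      ⟨fun H x hx ζ' hζ' => ?_, fun H x hx ζ hζ => ?_⟩
  · let W : SESData R := ofEpi x hx.2
    obtain ⟨ζ, hζ⟩ := exists_sub_hom (X := W) ζ'
    obtain ⟨ρ, hρ⟩ := H W.sub (inG_sub_iff.2 hx) ζ (mt (splitEpi_iff (X := W) hζ).1 hζ')
    obtain ⟨ρ', hρ'⟩ := exists_quo_hom (X := W) ρ
    exact ⟨ρ', (comp_iff (X := W) hρ' hη hζ).1 hρ⟩
  · let W : SESData R := ofMono x hx.1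
    obtain ⟨ζ', hζ'⟩ := exists_quo_hom (X := W) ζ
    obtain ⟨ρ', hρ'⟩ := H W.quo (inG_sub_iff.1 hx) ζ' (mt (splitEpi_iff (X := W) hζ').2 hζ)
    obtain ⟨ρ, hρ⟩ := exists_sub_hom (X := W) ρ'
    exact ⟨ρ, (comp_iff (X := W) hρ hη hζ').2 hρ'⟩

end SESData

end CokernelFunctor

theorem statement19 (R : Type) [CommRing R] [IsLocalRing R]
    [IsAdicComplete (IsLocalRing.maximalIdeal R) R]
    (hGor : IsGorensteinLocal R)
    (a b c : MObj R) (ha : InG a) (hb : InG b) (hc : InG c)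
    (φ : MHom a b) (ψ : MHom b c) (hses : MShortExact φ ψ)
    (φ' : MHom (CokObj a) (CokObj b)) (ψ' : MHom (CokObj b) (CokObj c))
    (hφ1 : φ'.h1 = φ.h2)
    (hφ2 : φ'.h2 ∘ₗ (LinearMap.range a.map).mkQ = (LinearMap.range b.map).mkQ ∘ₗ φ.h2)
    (hψ1 : ψ'.h1 = ψ.h2)
    (hψ2 : ψ'.h2 ∘ₗ (LinearMap.range b.map).mkQ = (LinearMap.range c.map).mkQ ∘ₗ ψ.h2) :
    IsAlmostSplitIn InG φ ψ ↔ IsAlmostSplitIn InE φ' ψ' := by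
  exact SESData.isAlmostSplitIn_iff (X := .ofMono a ha.1) (Y := .ofMono b hb.1)
    (Z := .ofMono c hc.1) hφ1 hψ1 hses
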